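/- Let k be a field, and let A be a ℤⁿ-graded k-algebra equipped with a 𝔾_mⁿ-equivariant, finite-type, quasi-finite morphism Spec(A) → 𝔸ⁿ_k (the standard torus action on 𝔸ⁿ). Then there is a unique decomposition Spec(A) = Spec(A') ⊔ Spec(B) into open and closed subschemes such that Spec(A') → 𝔸ⁿ_k is finite and the image of Spec(B) → 𝔸ⁿ_k does not contain the origin (0,…,0). -/

import Mathlib

open MvPolynomial

section Coaction

variable {ι k A : Type*} [DecidableEq ι] [AddMonoid ι] [CommRing k] [CommRing A] [Algebra k A]
  (𝒜 : ι → Submodule k A) [GradedAlgebra 𝒜] (w : ι →+ ℤ)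

/-- The coaction `A → A[T;T⁻¹]` of the one-parameter subgroup attached to a weight `w` on a
graded algebra: an element `a` of degree `d` is sent to `a T ^ (w d)`. -/
noncomputable def weightCoaction : A →ₐ[k] LaurentPolynomial A :=
  (DirectSum.toAlgebra k (fun d ↦ 𝒜 d)
    (fun d ↦ AddMonoidAlgebra.lsingle (w d) ∘ₗ (𝒜 d).subtype)
    (by simp [AddMonoidAlgebra.one_def, -LaurentPolynomial.single_eq_C_mul_T])
    (fun {i j} a b ↦ by simp [-LaurentPolynomial.single_eq_C_mul_T])).comp
    (DirectSum.decomposeAlgEquiv 𝒜).toAlgHom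

variable {𝒜}

lemma weightCoaction_of_mem {d : ι} {a : A} (ha : a ∈ 𝒜 d) :
    weightCoaction 𝒜 w a = AddMonoidAlgebra.single (w d) a := by
  lift a to 𝒜 d using ha
  change DirectSum.toAddMonoid (fun d ↦ ((AddMonoidAlgebra.lsingle (R := k) (w d)).comp
    (𝒜 d).subtype).toAddMonoidHom) (DirectSum.decompose 𝒜 (a : A)) = _
  rw [DirectSum.decompose_coe, DirectSum.toAddMonoid_of]
  rfl

variable (𝒜)

lemma weightCoaction_coeff_sum (a : A) :
    (weightCoaction 𝒜 w a).coeff.sum (fun _ r ↦ r) = a := by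
  induction a using DirectSum.Decomposition.inductionOn 𝒜 with
  | zero => simp
  | homogeneous x =>
    rw [weightCoaction_of_mem w x.2]
    simp [-LaurentPolynomial.single_eq_C_mul_T]
  | add x y hx hy =>
    rw [map_add, AddMonoidAlgebra.coeff_add, Finsupp.sum_add_index' (by simp) (by simp), hx, hy]

lemma mem_of_forall_weightCoaction_coeff_mem (I : Ideal A) {a : A}
    (h : ∀ m, (weightCoaction 𝒜 w a).coeff m ∈ I) : a ∈ I := by
  rw [← weightCoaction_coeff_sum 𝒜 w a]
  exact Ideal.sum_mem _ fun m _ ↦ h m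

lemma weightCoaction_injective : Function.Injective (weightCoaction 𝒜 w) :=
  (injective_iff_map_eq_zero _).mpr fun a ha ↦
    mem_of_forall_weightCoaction_coeff_mem 𝒜 w ⊥ (by simp [ha])

lemma weightCoaction_weightCoaction_coeff (a : A) (m : ℤ) :
    weightCoaction 𝒜 w ((weightCoaction 𝒜 w a).coeff m) =
      AddMonoidAlgebra.single m ((weightCoaction 𝒜 w a).coeff m) := by
  induction a using DirectSum.Decomposition.inductionOn 𝒜 with
  | zero => simp
  | @homogeneous d x =>
    rw [weightCoaction_of_mem w x.2, AddMonoidAlgebra.coeff_single, Finsupp.single_apply]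
    split_ifs with h
    · rw [weightCoaction_of_mem w x.2, h]
    · simp
  | add x y hx hy => simp [hx, hy]

variable {𝒜} in
lemma weightCoaction_coeff_mul_of_mem {d : ι} {x : A} (hx : x ∈ 𝒜 d) (a : A) (m : ℤ) :
    (weightCoaction 𝒜 w (a * x)).coeff (m + w d) = (weightCoaction 𝒜 w a).coeff m * x := by
  rw [map_mul, weightCoaction_of_mem w hx, AddMonoidAlgebra.coeff_mul_single_add]

end Coaction

section PolynomialBase

variable {σ ι k A : Type*} [DecidableEq ι] [AddMonoid ι] [CommRing k] [CommRing A]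
  [Algebra k A] [Algebra (MvPolynomial σ k) A]

/-- The coaction of the standard scaling action on affine space. -/
noncomputable def scalingCoaction (σ k : Type*) [CommRing k] :
    MvPolynomial σ k →ₐ[k] Polynomial (MvPolynomial σ k) :=
  aeval fun i ↦ Polynomial.C (X i) * Polynomial.X

lemma scalingCoaction_coeff_zero (s : MvPolynomial σ k) :
    (scalingCoaction σ k s).coeff 0 = C (constantCoeff s) := by
  suffices h : (Polynomial.constantCoeff.comp (scalingCoaction σ k).toRingHom) =
      (C.comp constantCoeff : MvPolynomial σ k →+* MvPolynomial σ k) from congr($h s)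
  ext <;> simp [scalingCoaction, Polynomial.algebraMap_apply, MvPolynomial.algebraMap_eq]

variable (𝒜 : ι → Submodule k A) [GradedAlgebra 𝒜] (w : ι →+ ℤ)

lemma weightCoaction_eval₂_coeff {m : ℤ} {a : A}
    (ha : weightCoaction 𝒜 w a = AddMonoidAlgebra.single m a)
    (p : Polynomial (MvPolynomial σ k)) (c : ℤ) :
    (weightCoaction 𝒜 w (p.eval₂ (algebraMap (MvPolynomial σ k) A) a)).coeff c =
      ∑ j ∈ Finset.range (p.natDegree + 1),
        (weightCoaction 𝒜 w (algebraMap (MvPolynomial σ k) A (p.coeff j))).coeff (c - j * m) *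
          a ^ j := by
  rw [Polynomial.eval₂_eq_sum_range, map_sum, AddMonoidAlgebra.coeff_sum, Finsupp.finsetSum_apply]
  refine Finset.sum_congr rfl fun j _ ↦ ?_
  rw [map_mul, map_pow, ha, AddMonoidAlgebra.single_pow, nsmul_eq_mul]
  conv_lhs => rw [← sub_add_cancel c (j * m)]
  exact AddMonoidAlgebra.coeff_mul_single_add _ _ _ _

variable [IsScalarTower k (MvPolynomial σ k) A]

lemma weightCoaction_algebraMap
    (hX : ∀ i : σ, ∃ d, w d = 1 ∧ algebraMap (MvPolynomial σ k) A (X i) ∈ 𝒜 d)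
    (s : MvPolynomial σ k) :
    weightCoaction 𝒜 w (algebraMap (MvPolynomial σ k) A s) =
      ((scalingCoaction σ k s).map (algebraMap (MvPolynomial σ k) A)).toLaurent := by
  suffices h : (weightCoaction 𝒜 w).toRingHom.comp (algebraMap (MvPolynomial σ k) A) =
      Polynomial.toLaurent.comp ((Polynomial.mapRingHom (algebraMap (MvPolynomial σ k) A)).comp
        (scalingCoaction σ k).toRingHom) from congr($h s)
  refine MvPolynomial.ringHom_ext (fun r ↦ ?_) fun i ↦ ?_
  · have : algebraMap (MvPolynomial σ k) A (C r) = algebraMap k A r :=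
      (IsScalarTower.algebraMap_apply k (MvPolynomial σ k) A r).symm
    simp [scalingCoaction, Polynomial.algebraMap_apply, MvPolynomial.algebraMap_eq, this,
      LaurentPolynomial.algebraMap_apply]
  · obtain ⟨d, hd, hi⟩ := hX i
    simp [scalingCoaction, weightCoaction_of_mem w hi, hd]

lemma IsIntegral.weightCoaction_coeff
    (hX : ∀ i : σ, ∃ d, w d = 1 ∧ algebraMap (MvPolynomial σ k) A (X i) ∈ 𝒜 d)
    {a : A} (ha : IsIntegral (MvPolynomial σ k) a) (m : ℤ) :
    IsIntegral (MvPolynomial σ k) ((weightCoaction 𝒜 w a).coeff m) := by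
  let S := MvPolynomial σ k
  let : Algebra (Polynomial S) (Polynomial A) := Polynomial.algebra S A
  let θ : Polynomial S →+* LaurentPolynomial A :=
    Polynomial.toLaurent.comp (Polynomial.mapRingHom (algebraMap S A))
  have h₁ : θ.IsIntegralElem (weightCoaction 𝒜 w a) := by
    obtain ⟨p, hp, h⟩ := ha
    refine ⟨p.map (scalingCoaction σ k).toRingHom, hp.map _, ?_⟩
    have hθ : θ.comp (scalingCoaction σ k).toRingHom =
        (weightCoaction 𝒜 w).toRingHom.comp (algebraMap S A) :=
      RingHom.ext fun s ↦ (weightCoaction_algebraMap 𝒜 w hX s).symm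
    rw [Polynomial.eval₂_map, hθ]
    change Polynomial.eval₂ _ ((weightCoaction 𝒜 w).toRingHom a) p = 0
    rw [← Polynomial.hom_eval₂, h, map_zero]
  obtain ⟨N, P, hP⟩ := LaurentPolynomial.exists_T_pow (weightCoaction 𝒜 w a)
  have h₂ : IsIntegral (Polynomial S) P := by
    have hT : θ.IsIntegralElem (LaurentPolynomial.T N) := by
      simpa [θ] using θ.isIntegralElem_map (x := Polynomial.X ^ N)
    obtain ⟨p, hp, h⟩ := h₁.mul θ hT
    refine ⟨p, hp, Polynomial.toLaurent_injective ?_⟩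
    rw [← hP] at h
    rw [map_zero, Polynomial.hom_eval₂]
    exact h
  have h₃ : (weightCoaction 𝒜 w a).coeff m = (Polynomial.toLaurent P).coeff (m + N) := by
    rw [hP, LaurentPolynomial.T, AddMonoidAlgebra.coeff_mul_single_add, mul_one]
  rw [h₃, LaurentPolynomial.coeff_toLaurent]
  by_cases hm : m + N ∈ Set.range (Nat.castEmbedding (R := ℤ))
  · obtain ⟨j, hj⟩ := hm
    rw [← hj, Finsupp.mapDomain_apply Nat.castEmbedding.injective]
    exact h₂.coeff j
  · rw [Finsupp.mapDomain_of_notMem_range _ _ hm]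
    exact isIntegral_zero

lemma weightCoaction_algebraMap_coeff_zero
    (hX : ∀ i : σ, ∃ d, w d = 1 ∧ algebraMap (MvPolynomial σ k) A (X i) ∈ 𝒜 d)
    (s : MvPolynomial σ k) :
    (weightCoaction 𝒜 w (algebraMap (MvPolynomial σ k) A s)).coeff 0 =
      algebraMap k A (constantCoeff s) := by
  rw [weightCoaction_algebraMap 𝒜 w hX, LaurentPolynomial.coeff_toLaurent]
  refine (Finsupp.mapDomain_apply Nat.castEmbedding.injective _ 0).trans ?_
  change (Polynomial.map _ _).coeff 0 = _
  rw [Polynomial.coeff_map, scalingCoaction_coeff_zero,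
    IsScalarTower.algebraMap_apply k (MvPolynomial σ k) A, MvPolynomial.algebraMap_eq]

lemma weightCoaction_algebraMap_coeff_mem
    (hX : ∀ i : σ, ∃ d, w d = 1 ∧ algebraMap (MvPolynomial σ k) A (X i) ∈ 𝒜 d)
    {I : Ideal A} (hI : ∀ i, algebraMap (MvPolynomial σ k) A (X i) ∈ I)
    (s : MvPolynomial σ k) {m : ℤ} (hm : m ≠ 0) :
    (weightCoaction 𝒜 w (algebraMap (MvPolynomial σ k) A s)).coeff m ∈ I := by
  rw [weightCoaction_algebraMap 𝒜 w hX, LaurentPolynomial.coeff_toLaurent]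
  by_cases hr : m ∈ Set.range (Nat.castEmbedding (R := ℤ))
  · obtain ⟨j, rfl⟩ := hr
    rw [Finsupp.mapDomain_apply Nat.castEmbedding.injective]
    change (Polynomial.map _ _).coeff j ∈ I
    have h : (Polynomial.mapRingHom ((Ideal.Quotient.mk I).comp
        (algebraMap (MvPolynomial σ k) A))).comp (scalingCoaction σ k).toRingHom =
        Polynomial.C.comp ((Ideal.Quotient.mk I).comp (algebraMap (MvPolynomial σ k) A)) := by
      refine MvPolynomial.ringHom_ext (fun r ↦ ?_) fun i ↦ ?_
      · simp [scalingCoaction, Polynomial.algebraMap_apply, MvPolynomial.algebraMap_eq]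
      · have := Ideal.Quotient.eq_zero_iff_mem.mpr (hI i)
        rw [Ideal.Quotient.mk_algebraMap] at this
        simp [scalingCoaction, this]
    have hj : j ≠ 0 := by rintro rfl; simp at hm
    have := congr(Polynomial.coeff ($h s) j)
    rw [← Ideal.Quotient.eq_zero_iff_mem]
    simpa [Polynomial.coeff_C, hj] using this
  · rw [Finsupp.mapDomain_of_notMem_range _ _ hr]
    exact I.zero_mem

lemma IsIntegral.of_weightCoaction_eq_single_zero
    (hX : ∀ i : σ, ∃ d, w d = 1 ∧ algebraMap (MvPolynomial σ k) A (X i) ∈ 𝒜 d)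
    {a : A} (ha : weightCoaction 𝒜 w a = AddMonoidAlgebra.single 0 a)
    (h : IsIntegral (MvPolynomial σ k) a) : IsIntegral k a := by
  nontriviality k
  obtain ⟨p, hp, h⟩ := h
  refine ⟨p.map constantCoeff, hp.map _, ?_⟩
  have := weightCoaction_eval₂_coeff 𝒜 w ha p 0
  rw [h, map_zero (weightCoaction 𝒜 w), AddMonoidAlgebra.coeff_zero, Finsupp.zero_apply] at this
  simp only [mul_zero, sub_zero, weightCoaction_algebraMap_coeff_zero 𝒜 w hX] at this
  rw [Polynomial.eval₂_eq_sum_range, hp.natDegree_map]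
  simpa using this.symm

lemma mem_of_weightCoaction_eq_single
    (hX : ∀ i : σ, ∃ d, w d = 1 ∧ algebraMap (MvPolynomial σ k) A (X i) ∈ 𝒜 d)
    {q : Ideal A} [q.IsPrime] (hq : ∀ i, algebraMap (MvPolynomial σ k) A (X i) ∈ q)
    {m : ℤ} (hm : m ≠ 0) {a : A} (ha : weightCoaction 𝒜 w a = AddMonoidAlgebra.single m a)
    (h : IsIntegral (MvPolynomial σ k) a) : a ∈ q := by
  obtain ⟨p, hp, h⟩ := h
  have := weightCoaction_eval₂_coeff 𝒜 w ha p (p.natDegree * m)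
  rw [h, map_zero (weightCoaction 𝒜 w), Finset.sum_range_succ, hp.coeff_natDegree,
    sub_self, map_one, map_one, AddMonoidAlgebra.one_def, AddMonoidAlgebra.coeff_single,
    Finsupp.single_eq_same, one_mul, AddMonoidAlgebra.coeff_zero, Finsupp.zero_apply] at this
  refine Ideal.IsPrime.mem_of_pow_mem ‹_› p.natDegree ?_
  rw [← neg_eq_of_add_eq_zero_right this.symm, neg_mem_iff]
  refine Ideal.sum_mem _ fun j hj ↦ Ideal.mul_mem_right _ _ ?_
  refine weightCoaction_algebraMap_coeff_mem 𝒜 w hX hq _ ?_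
  rw [← sub_mul]
  have := Finset.mem_range.mp hj
  exact mul_ne_zero (by lia) hm

lemma eq_zero_of_algebraMap_mul_eq_zero
    (hX : ∀ i : σ, ∃ d, w d = 1 ∧ algebraMap (MvPolynomial σ k) A (X i) ∈ 𝒜 d)
    {s : MvPolynomial σ k} (hs : constantCoeff s = 1) {a : A}
    (h : algebraMap (MvPolynomial σ k) A s * a = 0) : a = 0 := by
  obtain ⟨N, P, hP⟩ := LaurentPolynomial.exists_T_pow (weightCoaction 𝒜 w a)
  have hs' : (scalingCoaction σ k s).map (algebraMap (MvPolynomial σ k) A) ∈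
      nonZeroDivisors (Polynomial A) := by
    refine Polynomial.mem_nonZeroDivisors_iff.mpr fun b hb ↦ ?_
    simpa [scalingCoaction_coeff_zero, hs] using congr(Polynomial.coeff $hb 0)
  have hP₀ : P = 0 := by
    refine (mul_left_mem_nonZeroDivisors_eq_zero_iff hs').mp (Polynomial.toLaurent_injective ?_)
    rw [map_mul, ← weightCoaction_algebraMap 𝒜 w hX, hP, ← mul_assoc, ← map_mul, h]
    simp
  apply weightCoaction_injective 𝒜 w
  rw [map_zero]
  exact (LaurentPolynomial.isUnit_T N).mul_left_eq_zero.mp (by rw [← hP, hP₀, map_zero])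

end PolynomialBase

section Idempotents

lemma IsIntegral.exists_isIdempotentElem_mul {k A : Type*} [Field k] [CommRing A] [Algebra k A]
    {a : A} (ha : IsIntegral k a) :
    ∃ u ∈ Algebra.adjoin k {a}, IsIdempotentElem (a * u) ∧ ∃ N : ℕ, a ^ N * (1 - a * u) = 0 := by
  obtain ⟨p, hp, h⟩ := ha
  rw [← Polynomial.aeval_def] at h
  obtain ⟨v, hv, hdvd⟩ := Polynomial.exists_eq_pow_rootMultiplicity_mul_and_not_dvd p hp.ne_zero 0
  set N := Polynomial.rootMultiplicity 0 p
  rw [Polynomial.C_0, sub_zero] at hv hdvd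
  obtain ⟨α, β, hαβ⟩ : IsCoprime (Polynomial.X ^ (N + 1)) v :=
    ((Polynomial.irreducible_X.coprime_iff_not_dvd).mpr hdvd).pow_left
  have hv' : a ^ N * Polynomial.aeval a v = 0 := by
    rw [hv] at h
    simpa using h
  have h₁ := congr(Polynomial.aeval a $hαβ)
  simp only [map_add, map_mul, map_pow, Polynomial.aeval_X, map_one] at h₁
  have h₂ : a ^ N * (1 - a * (Polynomial.aeval a α * a ^ N)) = 0 := by
    linear_combination (-a ^ N) * h₁ + Polynomial.aeval a β * hv'
  refine ⟨Polynomial.aeval a α * a ^ N, mul_mem (Polynomial.aeval_mem_adjoin_singleton k a)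
    (pow_mem (Algebra.self_mem_adjoin_singleton k a) N), ?_, N, h₂⟩
  rw [IsIdempotentElem]
  linear_combination (-a * Polynomial.aeval a α) * h₂

lemma IsIdempotentElem.forall_isIntegral_mul {R A : Type*} [CommRing R] [CommRing A]
    [Algebra R A] {e : A} (he : IsIdempotentElem e) (hint : IsIntegral R e) {s : Set A}
    (hs : Algebra.adjoin R s = ⊤) (h : ∀ x ∈ s, IsIntegral R (e * x)) (x : A) :
    IsIntegral R (e * x) := by
  have hx : x ∈ Algebra.adjoin R s := hs ▸ Algebra.mem_top
  induction hx using Algebra.adjoin_induction with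
  | mem x hx => exact h x hx
  | algebraMap r => exact hint.mul isIntegral_algebraMap
  | add x y _ _ hx hy => rw [mul_add]; exact hx.add hy
  | mul x y _ _ hx hy =>
    have : e * (x * y) = e * x * (e * y) := by linear_combination (-(x * y)) * he.eq
    exact this ▸ hx.mul hy

lemma exists_isIdempotentElem_forall_isIntegral_mul {R A : Type*} [CommRing R] [CommRing A]
    [Algebra R A] {J : Ideal A}
    (h : ∀ q : Ideal A, q.IsPrime → J ≤ q →
      ∃ e ∉ q, IsIdempotentElem e ∧ ∀ x, IsIntegral R (e * x)) :
    ∃ e, IsIdempotentElem e ∧ (∀ x, IsIntegral R (e * x)) ∧ Ideal.span {e} ⊔ J = ⊤ := by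
  let E : Set A := {e | IsIdempotentElem e ∧ ∀ x, IsIntegral R (e * x)}
  have hE : Ideal.span E ⊔ J = ⊤ := by
    by_contra hne
    obtain ⟨q, hq, hle⟩ := Ideal.exists_le_maximal _ hne
    obtain ⟨e, heq, he⟩ := h q hq.isPrime (le_sup_right.trans hle)
    exact heq (hle (Ideal.mem_sup_left (Ideal.subset_span he)))
  have habs : ∀ i ∈ Ideal.span E, ∃ e ∈ E, e * i = i := by
    intro i hi
    induction hi using Submodule.span_induction with
    | mem e he => exact ⟨e, he, he.1⟩
    | zero => exact ⟨0, ⟨.zero, fun x ↦ by simpa using isIntegral_zero⟩, mul_zero 0⟩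
    | smul a i _ hi =>
      obtain ⟨e, he, hei⟩ := hi
      exact ⟨e, he, by rw [smul_eq_mul, mul_left_comm, hei]⟩
    | add i j _ _ hi hj =>
      obtain ⟨e, he, hei⟩ := hi
      obtain ⟨f, hf, hfj⟩ := hj
      refine ⟨e + f - e * f, ⟨?_, fun x ↦ ?_⟩, ?_⟩
      · have h₁ := he.1.eq
        have h₂ := hf.1.eq
        rw [IsIdempotentElem]
        linear_combination (1 - 2 * f + f * f) * h₁ + (1 - e) * h₂
      · have : (e + f - e * f) * x = e * x + f * x - e * (f * x) := by ring
        exact this ▸ ((he.2 x).add (hf.2 x)).sub (he.2 _)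
      · linear_combination (1 - f) * hei + (1 - e) * hfj
  obtain ⟨i, hi, j, hj, hij⟩ := Submodule.mem_sup.mp (hE ▸ Submodule.mem_top : (1 : A) ∈ _)
  obtain ⟨e, he, hei⟩ := habs i hi
  refine ⟨e, he.1, he.2, (Ideal.eq_top_iff_one _).mpr ?_⟩
  rw [← hij, ← hei]
  exact add_mem (Ideal.mem_sup_left (Ideal.mul_mem_right _ _ (Ideal.mem_span_singleton_self e)))
    (Ideal.mem_sup_right hj)

lemma IsIdempotentElem.exists_smul_eq_zero_of_finite_quotient {R A : Type*} [CommRing R]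
    [CommRing A] [Algebra R A] {I : Ideal R} {e f : A} [Module.Finite R (A ⧸ Ideal.span {1 - e})]
    (hf : IsIdempotentElem f) (hef : e * f = f) (hI : f ∈ I.map (algebraMap R A)) :
    ∃ r : R, r - 1 ∈ I ∧ algebraMap R A r * f = 0 := by
  have hker : Ideal.span {1 - e} ≤ LinearMap.ker (LinearMap.mulLeft A f) := by
    rw [Ideal.span_singleton_le_iff_mem, LinearMap.mem_ker, LinearMap.mulLeft_apply]
    linear_combination -hef
  let φ : (A ⧸ Ideal.span {1 - e}) →ₗ[R] A :=
    ((Ideal.span {1 - e}).liftQ (LinearMap.mulLeft A f) hker).restrictScalars R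
  have hφ (a : A) : f * a ∈ LinearMap.range φ := ⟨Ideal.Quotient.mk _ a, rfl⟩
  have hfg : (LinearMap.range φ).FG := Module.Finite.iff_fg.mp (Module.Finite.range φ)
  have hmul {g : A} (hg : g ∈ I.map (algebraMap R A)) :
      ∀ a, g * (f * a) ∈ I • LinearMap.range φ := by
    induction hg using Submodule.span_induction with
    | zero => simp
    | mem g hg =>
      obtain ⟨r, hr, rfl⟩ := hg
      intro a
      rw [← Algebra.smul_def]
      exact Submodule.smul_mem_smul hr (hφ a)
    | add g g' _ _ hg hg' =>
      intro a
      rw [add_mul]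
      exact add_mem (hg a) (hg' a)
    | smul c g _ hg =>
      intro a
      convert hg (c * a) using 1
      rw [smul_eq_mul]
      ring
  have hle : LinearMap.range φ ≤ I • LinearMap.range φ := by
    rintro _ ⟨x, rfl⟩
    obtain ⟨a, rfl⟩ := Ideal.Quotient.mk_surjective x
    change f * a ∈ _
    rw [← hf.eq, mul_assoc]
    exact hmul hI a
  obtain ⟨r, hr, h⟩ := Submodule.exists_sub_one_mem_and_smul_eq_zero_of_fg_of_le_smul _ _ hfg hle
  refine ⟨r, hr, ?_⟩
  rw [← Algebra.smul_def]
  exact h f (by simpa using hφ 1)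

end Idempotents

section GradedQuasiFinite

variable {σ ι k A : Type*} [DecidableEq ι] [AddMonoid ι] [Field k] [CommRing A]
  [Algebra k A] [Algebra (MvPolynomial σ k) A] [IsScalarTower k (MvPolynomial σ k) A]
  (𝒜 : ι → Submodule k A) [GradedAlgebra 𝒜] (w : ι →+ ℤ)

lemma exists_isIdempotentElem_notMem_of_quasiFinite
    [Algebra.FiniteType (MvPolynomial σ k) A] [Algebra.QuasiFinite (MvPolynomial σ k) A]
    (hX : ∀ i : σ, ∃ d, w d = 1 ∧ algebraMap (MvPolynomial σ k) A (X i) ∈ 𝒜 d)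
    {q : Ideal A} [q.IsPrime] (hq : ∀ i, algebraMap (MvPolynomial σ k) A (X i) ∈ q) :
    ∃ e ∉ q, IsIdempotentElem e ∧ ∀ x, IsIntegral (MvPolynomial σ k) (e * x) := by
  classical
  obtain ⟨s, hs, hhom⟩ : ∃ s : Finset A, Algebra.adjoin (MvPolynomial σ k) (s : Set A) = ⊤ ∧
      ∀ x ∈ s, ∃ d, x ∈ 𝒜 d := by
    obtain ⟨F, hF⟩ := Algebra.FiniteType.out (R := MvPolynomial σ k) (A := A)
    refine ⟨F.biUnion fun x ↦ (DirectSum.decompose 𝒜 x).support.image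
      fun d ↦ (DirectSum.decompose 𝒜 x d : A), ?_, ?_⟩
    · rw [← top_le_iff, ← hF, Algebra.adjoin_le_iff]
      intro x hx
      rw [← DirectSum.sum_support_decompose 𝒜 x]
      refine sum_mem fun d hd ↦ Algebra.subset_adjoin ?_
      simp only [Finset.coe_biUnion, Set.mem_iUnion, Finset.mem_coe, Finset.mem_image]
      exact ⟨x, hx, d, hd, rfl⟩
    · intro y hy
      simp only [Finset.mem_biUnion, Finset.mem_image] at hy
      obtain ⟨x, -, d, -, rfl⟩ := hy
      exact ⟨d, SetLike.coe_mem _⟩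
  obtain ⟨r, hrq, hr, hrx⟩ := Algebra.zariskisMainProperty_iff.mp
    (Algebra.ZariskisMainProperty.of_finiteType_of_weaklyQuasiFiniteAt
      (R := MvPolynomial σ k) q)
  choose m hm using hrx
  let g := r ^ s.sup m
  have hg : IsIntegral (MvPolynomial σ k) g := hr.pow _
  have hgx (x) (hx : x ∈ s) : IsIntegral (MvPolynomial σ k) (g * x) := by
    have : g * x = r ^ (s.sup m - m x) * (r ^ m x * x) := by
      rw [← mul_assoc, pow_sub_mul_pow _ (Finset.le_sup hx)]
    exact this ▸ (hr.pow _).mul (hm x)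
  have hgq : g ∉ q := fun h ↦ hrq (Ideal.IsPrime.mem_of_pow_mem ‹_› _ h)
  obtain ⟨c, hc⟩ : ∃ c, (weightCoaction 𝒜 w g).coeff c ∉ q := by
    by_contra! h
    exact hgq (mem_of_forall_weightCoaction_coeff_mem 𝒜 w q h)
  obtain rfl : c = 0 := by
    by_contra hne
    exact hc (mem_of_weightCoaction_eq_single 𝒜 w hX hq hne
      (weightCoaction_weightCoaction_coeff 𝒜 w g c) (hg.weightCoaction_coeff 𝒜 w hX c))
  set g₀ := (weightCoaction 𝒜 w g).coeff 0 with hg₀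
  have hg₀int : IsIntegral (MvPolynomial σ k) g₀ := hg.weightCoaction_coeff 𝒜 w hX 0
  have hg₀x (x) (hx : x ∈ s) : IsIntegral (MvPolynomial σ k) (g₀ * x) := by
    obtain ⟨d, hd⟩ := hhom x hx
    rw [hg₀, ← weightCoaction_coeff_mul_of_mem w hd]
    exact (hgx x hx).weightCoaction_coeff 𝒜 w hX _
  have hg₀k : IsIntegral k g₀ := hg₀int.of_weightCoaction_eq_single_zero 𝒜 w hX
    (weightCoaction_weightCoaction_coeff 𝒜 w g 0)
  obtain ⟨u, hu, hidem, N, hN⟩ := hg₀k.exists_isIdempotentElem_mul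
  have huint : IsIntegral (MvPolynomial σ k) u :=
    IsIntegral.tower_top (R := k) (adjoin_le_integralClosure hg₀k hu)
  refine ⟨g₀ * u, fun h ↦ ?_, hidem, hidem.forall_isIntegral_mul (hg₀int.mul huint) hs
    fun x hx ↦ ?_⟩
  · have : g₀ ^ N * (1 - g₀ * u) ∈ q := hN ▸ q.zero_mem
    rcases Ideal.IsPrime.mem_or_mem ‹_› this with h' | h'
    · exact hc (Ideal.IsPrime.mem_of_pow_mem ‹_› _ h')
    · exact Ideal.IsPrime.one_notMem ‹_› (by simpa using add_mem h' h)
  · rw [mul_right_comm]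
    exact (hg₀x x hx).mul huint

end GradedQuasiFinite

/-- Let `k` be a field and `A` a `ℤⁿ`-graded `k`-algebra with a
`𝔾ₘⁿ`-equivariant (i.e. graded, where `xᵢ` has the `i`-th standard degree),
finite-type, quasi-finite morphism `Spec A → 𝔸ⁿ_k`.  Then there is a unique
decomposition `Spec A = Spec A' ⊔ Spec B` into open and closed subschemes —
i.e. a unique idempotent `e ∈ A` with `A' = A/(1−e)` and `B = A/(e)` — such that
`Spec A' → 𝔸ⁿ_k` is finite and the image of `Spec B → 𝔸ⁿ_k` does not contain the
origin (i.e. the fiber of `Spec B` over the origin is empty). -/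
theorem stmt11 {k : Type*} [Field k] {n : ℕ} {A : Type*} [CommRing A]
    [Algebra k A] [Algebra (MvPolynomial (Fin n) k) A]
    [IsScalarTower k (MvPolynomial (Fin n) k) A]
    (𝒜 : (Fin n → ℤ) → Submodule k A) [GradedAlgebra 𝒜]
    (hgraded : ∀ i : Fin n,
      algebraMap (MvPolynomial (Fin n) k) A (X i) ∈ 𝒜 (Pi.single i 1))
    (hft : Algebra.FiniteType k A)
    (hqf : ∀ p : PrimeSpectrum (MvPolynomial (Fin n) k),
      {q : PrimeSpectrum A |
        PrimeSpectrum.comap (algebraMap (MvPolynomial (Fin n) k) A) q = p}.Finite) :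
    ∃! e : A, IsIdempotentElem e ∧
      Module.Finite (MvPolynomial (Fin n) k) (A ⧸ Ideal.span {1 - e}) ∧
      Ideal.span ({e} ∪
        Set.range fun i : Fin n => algebraMap (MvPolynomial (Fin n) k) A (X i)) = ⊤ := by
  have := Algebra.FiniteType.of_restrictScalars_finiteType k (MvPolynomial (Fin n) k) A
  have : Algebra.QuasiFinite (MvPolynomial (Fin n) k) A :=
    Algebra.QuasiFinite.iff_finite_comap_preimage_singleton.mpr hqf
  let w : (Fin n → ℤ) →+ ℤ := ∑ i, Pi.evalAddMonoidHom (fun _ ↦ ℤ) i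
  have hX (i : Fin n) : ∃ d, w d = 1 ∧ algebraMap (MvPolynomial (Fin n) k) A (X i) ∈ 𝒜 d :=
    ⟨Pi.single i 1, by simp [w], hgraded i⟩
  let I : Ideal (MvPolynomial (Fin n) k) := Ideal.span (Set.range X)
  let J : Ideal A := I.map (algebraMap (MvPolynomial (Fin n) k) A)
  have hJ : J = Ideal.span (Set.range fun i : Fin n ↦
      algebraMap (MvPolynomial (Fin n) k) A (X i)) := by
    rw [show J = Ideal.map _ (Ideal.span (Set.range X)) from rfl, Ideal.map_span, ← Set.range_comp]
    rfl
  have hI {s : MvPolynomial (Fin n) k} (hs : s ∈ I) : constantCoeff s = 0 := by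
    have : I ≤ RingHom.ker (constantCoeff (σ := Fin n) (R := k)) :=
      Ideal.span_le.mpr (by rintro _ ⟨i, rfl⟩; simp)
    exact this hs
  have hle {e f : A} (he : IsIdempotentElem e)
      (hfin : Module.Finite (MvPolynomial (Fin n) k) (A ⧸ Ideal.span {1 - e}))
      (hf : IsIdempotentElem f) (hfJ : Ideal.span {f} ⊔ J = ⊤) : e * (1 - f) = 0 := by
    have hf₁ : 1 - f ∈ J := by
      obtain ⟨y, hy, j, hj, hyj⟩ :=
        Submodule.mem_sup.mp (hfJ ▸ Submodule.mem_top : (1 : A) ∈ _)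
      obtain ⟨a, rfl⟩ := Ideal.mem_span_singleton'.mp hy
      have : 1 - f = (1 - f) * j := by linear_combination (f - 1) * hyj - a * hf.eq
      exact this ▸ J.mul_mem_left _ hj
    obtain ⟨r, hr, hr₀⟩ := (he.mul hf.one_sub).exists_smul_eq_zero_of_finite_quotient (I := I)
      (e := e) (by rw [← mul_assoc, he.eq]) (J.mul_mem_left _ hf₁)
    refine eq_zero_of_algebraMap_mul_eq_zero 𝒜 w hX ?_ hr₀
    simpa [sub_eq_zero] using hI hr
  simp only [Ideal.span_union, ← hJ]
  obtain ⟨e, he, hint, htop⟩ := exists_isIdempotentElem_forall_isIntegral_mul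
    (R := MvPolynomial (Fin n) k) (J := J) fun q hq hJq ↦
      exists_isIdempotentElem_notMem_of_quasiFinite 𝒜 w hX fun i ↦
        hJq (hJ ▸ Ideal.subset_span ⟨i, rfl⟩)
  have hfin : Module.Finite (MvPolynomial (Fin n) k) (A ⧸ Ideal.span {1 - e}) := by
    have : Algebra.IsIntegral (MvPolynomial (Fin n) k) (A ⧸ Ideal.span {1 - e}) := by
      refine ⟨fun y ↦ ?_⟩
      obtain ⟨x, rfl⟩ := Ideal.Quotient.mk_surjective y
      have : Ideal.Quotient.mk (Ideal.span {1 - e}) x = Ideal.Quotient.mk _ (e * x) :=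
        Ideal.Quotient.eq.mpr (Ideal.mem_span_singleton'.mpr ⟨x, by ring⟩)
      rw [this]
      exact (hint x).map (Ideal.Quotient.mkₐ (MvPolynomial (Fin n) k) (Ideal.span {1 - e}))
    exact Algebra.IsIntegral.finite
  refine ⟨e, ⟨he, hfin, htop⟩, ?_⟩
  rintro f ⟨hf, hffin, hftop⟩
  linear_combination hle hf hffin he htop - hle he hfin hf hftop
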